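/- Assume J(1) = 0 and that the multiplicative MHDM iterates u_k with partial products x_k are well-defined. Then for every k ≥ 0 one has λ_k·H(f^δ, T x_k) + J(u_k) ≤ λ_k·H(f^δ, T x_{k-1}), and consequently the residual sequence k ↦ H(f^δ, T x_k) is nonincreasing. -/

import Mathlib

open scoped ENNReal

/-- Multiplicative MHDM (abstract setting): `Hres v` stands for the data fidelity
`H(f^δ, T v)`, `J` is the penalty, `x (k+1) = ∏_{j=0}^k u j` are the partial products
(`x 0 = 1` plays the role of `x₋₁`), and `u k` minimizes
`v ↦ λ_k H(f^δ, T (v x_{k-1})) + J v`.  If `J 1 = 0`, then for every `k ≥ 0`,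
`λ_k H(f^δ, T x_k) + J(u_k) ≤ λ_k H(f^δ, T x_{k-1})`, and consequently the residual
sequence `k ↦ H(f^δ, T x_k)` is nonincreasing. -/
theorem mhdm_residual_monotone {G : Type*} [CommGroup G]
    (Hres J : G → ℝ≥0∞)
    (lam : ℕ → ℝ≥0∞) (hlam0 : 0 < lam 0) (hlam0top : lam 0 ≠ ⊤)
    (hlam : ∀ k, lam (k + 1) = 2 * lam k)
    (u x : ℕ → G) (hx0 : x 0 = 1) (hxs : ∀ k, x (k + 1) = u k * x k)
    (hJ1 : J 1 = 0)
    (hmin : ∀ k, ∀ v : G,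
      lam k * Hres (x (k + 1)) + J (u k) ≤ lam k * Hres (v * x k) + J v) :
    (∀ k, lam k * Hres (x (k + 1)) + J (u k) ≤ lam k * Hres (x k)) ∧
      Antitone (fun k => Hres (x (k + 1))) := by
  have hstep : ∀ k, lam k * Hres (x (k + 1)) + J (u k) ≤ lam k * Hres (x k) := fun k => by
    simpa [hJ1] using hmin k 1
  have hlam_pos_fin : ∀ k, lam k ≠ 0 ∧ lam k ≠ ⊤ := fun k => by
    induction k with
    | zero => exact ⟨hlam0.ne', hlam0top⟩
    | succ k ih =>
      rw [hlam]
      exact ⟨mul_ne_zero two_ne_zero ih.1, ENNReal.mul_ne_top ENNReal.ofNat_ne_top ih.2⟩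
  refine ⟨hstep, antitone_nat_of_succ_le fun k => ?_⟩
  obtain ⟨hne, hfin⟩ := hlam_pos_fin (k + 1)
  exact (ENNReal.mul_le_mul_iff_right hne hfin).1 (le_self_add.trans (hstep (k + 1)))
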